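/- Assume S = (M_p)_{p∈P} is a basic, multiparty compatible communicating system. If s is reachable, s →^{pp'!a} s', and s' →^{φ} s'' where φ contains no receive action pp'?a, then from s'' there is a continuation φ' and a transition with action pp'?a: s'' →^{φ'} s₂ →^{pp'?a} s₃ (general input availability). -/

import Mathlib

/-- Actions of communicating finite state machines:
`send p q a` is the sending of message `a` from `p` to `q` (action `pq!a`),
`recv p q a` is the reception of `a` from `p` by `q` (action `pq?a`). -/
inductive Act (P A : Type) : Type
  | send (p q : P) (a : A)
  | recv (p q : P) (a : A)

namespace Act
variable {P A : Type}

/-- The subject (principal in charge) of an action. -/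
def subj : Act P A → P
  | send p _ _ => p
  | recv _ q _ => q

/-- The partner of an action. -/
def partner : Act P A → P
  | send _ q _ => q
  | recv p _ _ => p

def isSend : Act P A → Bool
  | send _ _ _ => true
  | recv _ _ _ => false

/-- The duality isomorphism Φ exchanging sends and receives. -/
def dual : Act P A → Act P A
  | send p q a => recv p q a
  | recv p q a => send p q a

end Act

/-- A communicating system: for each participant a CFSM given by its
transition relation and initial state (all machines share the state space `Q`
and alphabet `A`; channels are ordered pairs of participants). -/
structure Sys (P Q A : Type) where
  delta : P → Q → Act P A → Q → Prop
  init : P → Q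

/-- A configuration: a local state for each machine and a FIFO buffer word
for each channel. -/
structure Config (P Q A : Type) where
  st : P → Q
  buf : P × P → List A

variable {P Q A : Type}

/-- One firing of a transition: a send appends to the corresponding buffer,
a receive consumes the head of the corresponding buffer; only the acting
machine changes its local state. -/
inductive Step [DecidableEq P] (S : Sys P Q A) :
    Config P Q A → Act P A → Config P Q A → Prop
  | send {c : Config P Q A} {p q : P} {a : A} {q' : Q} :
      S.delta p (c.st p) (.send p q a) q' →
      Step S c (.send p q a)
        ⟨Function.update c.st p q',
         Function.update c.buf (p, q) (c.buf (p, q) ++ [a])⟩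
  | recv {c : Config P Q A} {p q : P} {a : A} {q' : Q} {w : List A} :
      S.delta q (c.st q) (.recv p q a) q' →
      c.buf (p, q) = a :: w →
      Step S c (.recv p q a)
        ⟨Function.update c.st q q', Function.update c.buf (p, q) w⟩

/-- Multi-step execution labelled by the sequence of fired actions. -/
inductive Steps [DecidableEq P] (S : Sys P Q A) :
    Config P Q A → List (Act P A) → Config P Q A → Prop
  | nil {c} : Steps S c [] c
  | cons {c c' c'' ℓ ℓs} : Step S c ℓ c' → Steps S c' ℓs c'' →
      Steps S c (ℓ :: ℓs) c''

/-- The initial configuration: initial states and empty buffers. -/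
def initConfig (S : Sys P Q A) : Config P Q A := ⟨S.init, fun _ => []⟩

def Reach [DecidableEq P] (S : Sys P Q A) (c : Config P Q A) : Prop :=
  ∃ φ, Steps S (initConfig S) φ c

/-- A configuration is stable when all buffers are empty. -/
def Stable (c : Config P Q A) : Prop := ∀ ch, c.buf ch = []

/-- Machine `p` only performs actions whose subject is `p`. -/
def Proper (S : Sys P Q A) : Prop :=
  ∀ p q ℓ q', S.delta p q ℓ q' → Act.subj ℓ = p

def Deterministic (S : Sys P Q A) : Prop :=
  ∀ p q ℓ q1 q2, S.delta p q ℓ q1 → S.delta p q ℓ q2 → q1 = q2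

/-- Every state is directed: all its outgoing actions involve the same partner. -/
def DirectedSys (S : Sys P Q A) : Prop :=
  ∀ p q ℓ1 q1 ℓ2 q2, S.delta p q ℓ1 q1 → S.delta p q ℓ2 q2 →
    Act.partner ℓ1 = Act.partner ℓ2

/-- No mixed states: no state has both sending and receiving outgoing actions. -/
def NoMixed (S : Sys P Q A) : Prop :=
  ∀ p q ℓ1 q1 ℓ2 q2, S.delta p q ℓ1 q1 → S.delta p q ℓ2 q2 →
    Act.isSend ℓ1 = Act.isSend ℓ2

/-- A system of basic CFSMs: deterministic, directed, no mixed states. -/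
def Basic (S : Sys P Q A) : Prop :=
  Proper S ∧ Deterministic S ∧ DirectedSys S ∧ NoMixed S

/-- 1-bounded reachability: reachable by executions in which no intermediate
buffer ever contains more than one message. -/
inductive Reach1 [DecidableEq P] (S : Sys P Q A) : Config P Q A → Prop
  | init : Reach1 S (initConfig S)
  | step {c ℓ c'} : Reach1 S c → Step S c ℓ c' →
      (∀ ch, (c'.buf ch).length ≤ 1) → Reach1 S c'

/-- Sequences of actions executable from a local state of machine `p`. -/
inductive LocalTr (S : Sys P Q A) (p : P) : Q → List (Act P A) → Prop
  | nil {q} : LocalTr S p q []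
  | cons {q q' ℓ ℓs} : S.delta p q ℓ q' → LocalTr S p q' ℓs →
      LocalTr S p q (ℓ :: ℓs)

/-- A transition of the associated CFSM of the subsystem without machine `i`:
a local transition of some machine other than `i` (product automaton,
no buffer constraints). -/
def PStep [DecidableEq P] (S : Sys P Q A) (i : P)
    (st : P → Q) (ℓ : Act P A) (st' : P → Q) : Prop :=
  ∃ p q', p ≠ i ∧ Act.subj ℓ = p ∧ S.delta p (st p) ℓ q' ∧
    st' = Function.update st p q'

/-- `Match S i st ℓs` : the subsystem without `i` can, from control state `st`,
produce the dual of every action of `ℓs` in order, interleaved with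
alternations (internal synchronisations) not involving machine `i`. -/
inductive Match [DecidableEq P] (S : Sys P Q A) (i : P) :
    (P → Q) → List (Act P A) → Prop
  | nil {st} : Match S i st []
  | alt {st st1 st2 p q a ℓs} : p ≠ i → q ≠ i →
      PStep S i st (.send p q a) st1 →
      PStep S i st1 (.recv p q a) st2 →
      Match S i st2 ℓs → Match S i st ℓs
  | dual {st st' ℓ ℓs} : PStep S i st (Act.dual ℓ) st' →
      Match S i st' ℓs → Match S i st (ℓ :: ℓs)

/-- Multiparty compatibility: from any 1-bounded reachable stable
configuration, any sequence of actions of any machine `i` is matched by dual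
actions of the rest of the system, up to alternations not involving `i`. -/
def MultipartyCompatible [DecidableEq P] (S : Sys P Q A) : Prop :=
  ∀ c, Reach1 S c → Stable c →
    ∀ i ℓs, LocalTr S i (c.st i) ℓs → Match S i c.st ℓs

section Helpers
variable [DecidableEq P] {S : Sys P Q A}

/-- Firing a receive early, when it is enabled: either the execution already
fires it, or it can be postponed to the end. -/
theorem recv_front (hB : Basic S) {p q : P} {a : A} {q' : Q}
    {c d : Config P Q A} {φ : List (Act P A)} (hs : Steps S c φ d) :
    ∀ {w : List A}, S.delta q (c.st q) (.recv p q a) q' → c.buf (p, q) = a :: w →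
    (∃ φ', Steps S ⟨Function.update c.st q q', Function.update c.buf (p, q) w⟩ φ' d ∧
        φ'.length < φ.length) ∨
    (∃ d', Step S d (.recv p q a) d' ∧
        Steps S ⟨Function.update c.st q q', Function.update c.buf (p, q) w⟩ φ d') := by
  obtain ⟨hP, hD, hDir, hN⟩ := hB
  induction hs with
  | nil =>
    intro w h1 h2
    exact Or.inr ⟨_, Step.recv h1 h2, Steps.nil⟩
  | @cons c c' c'' ℓ ℓs hst hss ih =>
    intro w h1 h2
    cases hst with
    | @send u v b r hd =>
      have huq : u ≠ q := by
        rintro rfl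
        have := hN _ _ _ _ _ _ hd h1
        simp [Act.isSend] at this
      have key : Step S ⟨Function.update c.st q q', Function.update c.buf (p, q) w⟩ (.send u v b)
          ⟨Function.update (Function.update c.st u r) q q',
            Function.update (Function.update c.buf (u, v) (c.buf (u, v) ++ [b])) (p, q)
              (if (p, q) = (u, v) then w ++ [b] else w)⟩ := by
        have := @Step.send P Q A _ S
          ⟨Function.update c.st q q', Function.update c.buf (p, q) w⟩ u v b r
          (by simpa [Function.update_of_ne huq] using hd)
        convert this using 2
        · exact Function.update_comm huq _ _ _
        · by_cases h : (p, q) = (u, v)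
          · rw [h]; simp
          · simp only [if_neg h]
            rw [Function.update_comm h, Function.update_of_ne (Ne.symm h)]
      have := @ih (if (p, q) = (u, v) then w ++ [b] else w)
        (by simpa [Function.update_of_ne huq.symm] using h1)
        (by
          by_cases h : (p, q) = (u, v)
          · rw [if_pos h, ← h]; simp [h2]
          · rw [if_neg h]; simp only; rw [Function.update_of_ne h]; exact h2)
      rcases this with ⟨φ', hφ, hl⟩ | ⟨d', hd', hφ⟩
      · exact Or.inl ⟨_, Steps.cons key hφ, by simpa using hl⟩
      · exact Or.inr ⟨_, hd', Steps.cons key hφ⟩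
    | @recv u v b r w' hd hb =>
      by_cases hvq : v = q
      · subst hvq
        have hpu := hDir _ _ _ _ _ _ hd h1
        simp only [Act.partner] at hpu
        subst hpu
        rw [h2] at hb
        obtain ⟨rfl, rfl⟩ := List.cons.inj hb
        have := hD _ _ _ _ _ hd h1
        subst this
        exact Or.inl ⟨_, hss, by simp⟩
      · have hch : (p, q) ≠ (u, v) := by
          intro h; exact hvq (Prod.mk.inj h).2.symm
        have key : Step S ⟨Function.update c.st q q', Function.update c.buf (p, q) w⟩
            (.recv u v b)
            ⟨Function.update (Function.update c.st v r) q q',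
              Function.update (Function.update c.buf (u, v) w') (p, q) w⟩ := by
          have := @Step.recv P Q A _ S
            ⟨Function.update c.st q q', Function.update c.buf (p, q) w⟩ u v b r w'
            (by simpa [Function.update_of_ne hvq] using hd)
            (by simpa [Function.update_of_ne hch.symm] using hb)
          convert this using 2
          · exact Function.update_comm hvq _ _ _
          · exact Function.update_comm hch.symm _ _ _
        have := @ih w (by simpa [Function.update_of_ne (Ne.symm hvq)] using h1)
          (by simp only; rw [Function.update_of_ne hch]; exact h2)
        rcases this with ⟨φ', hφ, hl⟩ | ⟨d', hd', hφ⟩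
        · exact Or.inl ⟨_, Steps.cons key hφ, by simpa using hl⟩
        · exact Or.inr ⟨_, hd', Steps.cons key hφ⟩

/-- Firing a send early: either the execution fires a send of the same machine on
the same channel (which is moved to the front), or the send can be added. -/
theorem send_front (hB : Basic S) {u v : P} {m : A} {r : Q}
    {c d : Config P Q A} {φ : List (Act P A)} (hs : Steps S c φ d) :
    S.delta u (c.st u) (.send u v m) r →
    (∃ m' r' φ', S.delta u (c.st u) (.send u v m') r' ∧
        Steps S ⟨Function.update c.st u r',
          Function.update c.buf (u, v) (c.buf (u, v) ++ [m'])⟩ φ' d ∧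
        φ'.length < φ.length) ∨
    (∃ d', Step S d (.send u v m) d' ∧
        Steps S ⟨Function.update c.st u r,
          Function.update c.buf (u, v) (c.buf (u, v) ++ [m])⟩ φ d') := by
  obtain ⟨hP, hD, hDir, hN⟩ := hB
  induction hs with
  | nil =>
    intro h1
    exact Or.inr ⟨_, Step.send h1, Steps.nil⟩
  | @cons c c' c'' ℓ ℓs hst hss ih =>
    intro h1
    cases hst with
    | @send x y b s hd =>
      by_cases hxu : x = u
      · subst hxu
        have hpu := hDir _ _ _ _ _ _ hd h1
        simp only [Act.partner] at hpu
        subst hpu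
        exact Or.inl ⟨b, s, _, hd, hss, by simp⟩
      · have hch : (x, y) ≠ (u, v) := by
          intro h; exact hxu (Prod.mk.inj h).1
        have key : ∀ (m' : A) (r' : Q), Step S ⟨Function.update c.st u r',
            Function.update c.buf (u, v) (c.buf (u, v) ++ [m'])⟩ (.send x y b)
            ⟨Function.update (Function.update c.st x s) u r',
              Function.update (Function.update c.buf (x, y) (c.buf (x, y) ++ [b])) (u, v)
                ((Function.update c.buf (x, y) (c.buf (x, y) ++ [b])) (u, v) ++ [m'])⟩ := by
          intro m' r'
          have := @Step.send P Q A _ S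
            ⟨Function.update c.st u r',
              Function.update c.buf (u, v) (c.buf (u, v) ++ [m'])⟩ x y b s
            (by simpa [Function.update_of_ne hxu] using hd)
          convert this using 2
          · exact Function.update_comm hxu _ _ _
          · simp only
            rw [Function.update_of_ne hch, Function.update_of_ne hch.symm,
              Function.update_comm hch]
        have hx : (Function.update c.st x s) u = c.st u := Function.update_of_ne (Ne.symm hxu) _ _
        have := ih (by simpa [hx] using h1)
        rcases this with ⟨m', r', φ', hdel, hφ, hl⟩ | ⟨d', hd', hφ⟩
        · exact Or.inl ⟨m', r', _, by simpa [hx] using hdel, Steps.cons (key _ _) hφ,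
            by simpa using hl⟩
        · exact Or.inr ⟨_, hd', Steps.cons (key _ _) hφ⟩
    | @recv x y b s w hd hb =>
      have hyu : y ≠ u := by
        rintro rfl
        have := hN _ _ _ _ _ _ hd h1
        simp [Act.isSend] at this
      have key : ∀ (m' : A) (r' : Q), Step S ⟨Function.update c.st u r',
          Function.update c.buf (u, v) (c.buf (u, v) ++ [m'])⟩ (.recv x y b)
          ⟨Function.update (Function.update c.st y s) u r',
            Function.update (Function.update c.buf (x, y) w) (u, v)
              ((Function.update c.buf (x, y) w) (u, v) ++ [m'])⟩ := by
        intro m' r'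
        have := @Step.recv P Q A _ S
          ⟨Function.update c.st u r',
            Function.update c.buf (u, v) (c.buf (u, v) ++ [m'])⟩ x y b s
          (if (x, y) = (u, v) then w ++ [m'] else w)
          (by simpa [Function.update_of_ne hyu] using hd)
          (by
            by_cases h : (x, y) = (u, v)
            · rw [if_pos h, ← h]; simp [hb]
            · rw [if_neg h]; simp only; rw [Function.update_of_ne h]; exact hb)
        convert this using 2
        · exact Function.update_comm hyu _ _ _
        · by_cases h : (x, y) = (u, v)
          · rw [h]; simp
          · simp only [if_neg h]
            rw [Function.update_of_ne (Ne.symm h), Function.update_comm h]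
      have hx : (Function.update c.st y s) u = c.st u := Function.update_of_ne hyu.symm _ _
      have := ih (by simpa [hx] using h1)
      rcases this with ⟨m', r', φ', hdel, hφ, hl⟩ | ⟨d', hd', hφ⟩
      · exact Or.inl ⟨m', r', _, by simpa [hx] using hdel, Steps.cons (key _ _) hφ,
          by simpa using hl⟩
      · exact Or.inr ⟨_, hd', Steps.cons (key _ _) hφ⟩

/-- A matched send has a partner different from the machine itself. -/
theorem match_ne {u v : P} {m : A} {st : P → Q} {L : List (Act P A)}
    (h : Match S u st L) : L = [.send u v m] → v ≠ u := by
  induction h with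
  | nil => intro h; simp at h
  | alt _ _ _ _ _ ih => exact ih
  | dual h1 _ _ =>
    intro h
    obtain ⟨rfl, rfl⟩ := List.cons.inj h
    obtain ⟨x, y, hx, hxs, _⟩ := h1
    simp only [Act.dual, Act.subj] at hxs
    rw [hxs]; exact hx

/-- A machine waiting for `u` can receive any message that `u` may send to it. -/
theorem match_recv (hB : Basic S) {u v : P} {m m' : A} {st : P → Q} {L : List (Act P A)}
    (h : Match S u st L) : L = [.send u v m'] →
    (∃ r, S.delta v (st v) (.recv u v m) r) → ∃ r, S.delta v (st v) (.recv u v m') r := by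
  obtain ⟨hP, hD, hDir, hN⟩ := hB
  induction h with
  | nil => intro h; simp at h
  | @alt st st1 st2 x y b ℓs hx hy h1 h2 _ ih =>
    rintro hL ⟨r, hr⟩
    obtain ⟨x', s, -, hxs, hd, rfl⟩ := h1
    simp only [Act.subj] at hxs
    subst hxs
    obtain ⟨y', t, -, hys, hd2, rfl⟩ := h2
    simp only [Act.subj] at hys
    subst hys
    have hxv : v ≠ x := by
      rintro rfl
      have := hN _ _ _ _ _ _ hd hr
      simp [Act.isSend] at this
    have hyv : v ≠ y := by
      rintro rfl
      rw [Function.update_of_ne hxv] at hd2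
      have := hDir _ _ _ _ _ _ hd2 hr
      simp only [Act.partner] at this
      exact hx this
    have := ih hL
    rw [Function.update_of_ne hyv, Function.update_of_ne hxv] at this
    exact this ⟨r, hr⟩
  | dual h1 _ _ =>
    intro h _
    obtain ⟨rfl, rfl⟩ := List.cons.inj h
    obtain ⟨x, y, hx, hxs, hd, _⟩ := h1
    simp only [Act.dual, Act.subj] at hxs hd
    subst hxs
    exact ⟨_, hd⟩

theorem steps_trans {c d e : Config P Q A} {φ ψ : List (Act P A)}
    (h : Steps S c φ d) (hde : Steps S d ψ e) : Steps S c (φ ++ ψ) e := by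
  induction h with
  | nil => exact hde
  | cons h1 _ ih => exact Steps.cons h1 (ih hde)

/-- One alternation from a stable configuration, giving a stable configuration. -/
theorem alt_reach {c : Config P Q A} (hr : Reach1 S c) (hst : Stable c) {u v : P} {m : A}
    {r s : Q} (huv : v ≠ u) (h1 : S.delta u (c.st u) (.send u v m) r)
    (h2 : S.delta v (c.st v) (.recv u v m) s) :
    Reach1 S ⟨Function.update (Function.update c.st u r) v s,
      Function.update (Function.update c.buf (u, v) (c.buf (u, v) ++ [m])) (u, v) []⟩ ∧
    Stable (⟨Function.update (Function.update c.st u r) v s,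
      Function.update (Function.update c.buf (u, v) (c.buf (u, v) ++ [m])) (u, v) []⟩ :
        Config P Q A) := by
  have hstab : Stable (⟨Function.update (Function.update c.st u r) v s,
      Function.update (Function.update c.buf (u, v) (c.buf (u, v) ++ [m])) (u, v) []⟩ :
        Config P Q A) := by
    intro ch
    by_cases h : ch = (u, v)
    · subst h; simp
    · simp [Function.update_of_ne h, hst ch]
  refine ⟨?_, hstab⟩
  have r1 := Reach1.step hr (Step.send h1) (by
    intro ch
    by_cases h : ch = (u, v)
    · subst h; simp [hst (u, v)]
    · simp [Function.update_of_ne h, hst ch])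
  refine Reach1.step r1 (Step.recv (by simpa [Function.update_of_ne huv] using h2)
    (by simp [hst (u, v)])) ?_
  intro ch
  rw [hstab ch]; simp

/-- The conclusion: a configuration from which a stable one can be reached. -/
def Completable (S : Sys P Q A) (d : Config P Q A) : Prop :=
  ∃ φ e, Steps S d φ e ∧ Stable e

theorem Completable.of_step {d d' : Config P Q A} {ℓ : Act P A} (h : Step S d ℓ d')
    (h' : Completable S d') : Completable S d := by
  obtain ⟨φ, e, h1, h2⟩ := h'
  exact ⟨_, e, Steps.cons h h1, h2⟩

theorem inner (hB : Basic S) (hMC : MultipartyCompatible S) (n : ℕ)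
    (IH : ∀ c d φ, Reach1 S c → Stable c → Steps S c φ d → φ.length ≤ n → Completable S d)
    {p q : P} {a : A} {st : P → Q} {L : List (Act P A)} (hM : Match S p st L) :
    L = [.send p q a] → ∀ c d φ, c.st = st → Reach1 S c → Stable c →
      Steps S c (.send p q a :: φ) d → φ.length ≤ n → Completable S d := by
  induction hM with
  | nil => intro h; simp at h
  | @alt st st1 st2 u v m ℓs hu hv h1 h2 hM ih =>
    rintro hL c d φ rfl hr hst hs hn
    obtain ⟨_, s, -, hxs, hd, rfl⟩ := h1
    simp only [Act.subj] at hxs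
    subst hxs
    obtain ⟨_, t, -, hys, hd2, rfl⟩ := h2
    simp only [Act.subj] at hys
    subst hys
    have hvu : v ≠ u := match_ne (hMC c hr hst u _ (LocalTr.cons hd LocalTr.nil)) rfl
    rw [Function.update_of_ne hvu] at hd2
    rcases send_front hB hs hd with ⟨m', r', φ', hdel, hφ, hl⟩ | ⟨d', hd', hφ⟩
    · obtain ⟨t', ht'⟩ := match_recv hB
        (hMC c hr hst u _ (LocalTr.cons hdel LocalTr.nil)) rfl ⟨_, hd2⟩
      obtain ⟨R, T⟩ := alt_reach hr hst hvu hdel ht'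
      simp only [List.length_cons] at hl
      rcases recv_front hB hφ (p := u) (q := v) (a := m') (q' := t') (w := [])
        (by simpa [Function.update_of_ne hvu] using ht') (by simp [hst (u, v)])
        with ⟨φ2, hφ2, hl2⟩ | ⟨d2, hd2', hφ2⟩
      · exact IH _ _ _ R T hφ2 (by omega)
      · exact (IH _ _ _ R T hφ2 (by omega)).of_step hd2'
    · obtain ⟨R, T⟩ := alt_reach hr hst hvu hd hd2
      rcases recv_front hB hφ (p := u) (q := v) (a := m) (q' := t) (w := [])
        (by simpa [Function.update_of_ne hvu] using hd2) (by simp [hst (u, v)])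
        with ⟨φ2, hφ2, hl2⟩ | ⟨d2, hd2', hφ2⟩
      · simp only [List.length_cons] at hl2
        exact (IH _ _ _ R T hφ2 (by omega)).of_step hd'
      · exact ((ih hL _ _ _ rfl R T hφ2 hn).of_step hd2').of_step hd'
  | dual h1 _ _ =>
    rintro h c d φ rfl hr hst hs hn
    obtain ⟨rfl, rfl⟩ := List.cons.inj h
    obtain ⟨_, t, hx, hxs, hd2, _⟩ := h1
    simp only [Act.dual, Act.subj] at hxs hd2
    subst hxs
    cases hs with
    | cons hst1 hs1 =>
      cases hst1 with
      | send hd =>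
        obtain ⟨R, T⟩ := alt_reach hr hst hx hd hd2
        rcases recv_front hB hs1 (p := p) (q := q) (a := a) (q' := t) (w := [])
          (by simpa [Function.update_of_ne hx] using hd2) (by simp [hst (p, q)])
          with ⟨φ2, hφ2, hl2⟩ | ⟨d2, hd2', hφ2⟩
        · exact IH _ _ _ R T hφ2 (by omega)
        · exact (IH _ _ _ R T hφ2 (by omega)).of_step hd2'

theorem completable (hB : Basic S) (hMC : MultipartyCompatible S) (n : ℕ) :
    ∀ c d φ, Reach1 S c → Stable c → Steps S c φ d → φ.length ≤ n → Completable S d := by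
  induction n with
  | zero =>
    intro c d φ hr hst hs hn
    cases hs with
    | nil => exact ⟨[], c, Steps.nil, hst⟩
    | cons _ _ => simp at hn
  | succ n IH =>
    intro c d φ hr hst hs hn
    cases hs with
    | nil => exact ⟨[], c, Steps.nil, hst⟩
    | cons h1 h2 =>
      have hs := Steps.cons h1 h2
      cases h1 with
      | send hd =>
        exact inner hB hMC n IH (hMC c hr hst _ _ (LocalTr.cons hd LocalTr.nil)) rfl c d _ rfl
          hr hst hs (by simpa using hn)
      | recv _ hb => rw [hst] at hb; simp at hb

theorem mem_step {c d : Config P Q A} {ℓ : Act P A} {p p' : P} {a : A}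
    (h : Step S c ℓ d) (hne : ℓ ≠ .recv p p' a) (ha : a ∈ c.buf (p, p')) :
    a ∈ d.buf (p, p') := by
  cases h with
  | @send u v b r hd =>
    by_cases hc : (p, p') = (u, v)
    · rw [hc] at ha ⊢; simp [ha]
    · simpa [Function.update_of_ne hc] using ha
  | @recv u v b r w hd hb =>
    by_cases hc : (p, p') = (u, v)
    · obtain ⟨rfl, rfl⟩ := Prod.mk.inj hc
      rw [hb] at ha
      rcases List.mem_cons.1 ha with rfl | ha
      · exact absurd rfl hne
      · simpa using ha
    · simpa [Function.update_of_ne hc] using ha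

theorem mem_steps {c d : Config P Q A} {φ : List (Act P A)} {p p' : P} {a : A}
    (h : Steps S c φ d) : Act.recv p p' a ∉ φ → a ∈ c.buf (p, p') → a ∈ d.buf (p, p') := by
  induction h with
  | nil => intro _ h; exact h
  | cons h1 _ ih =>
    intro hn ha
    simp only [List.mem_cons, not_or] at hn
    exact ih hn.2 (mem_step h1 (Ne.symm hn.1) ha)

theorem split_recv {c e : Config P Q A} {φ : List (Act P A)} {p p' : P} {a : A}
    (h : Steps S c φ e) : Stable e → a ∈ c.buf (p, p') →
    ∃ φ' c2 c3, Steps S c φ' c2 ∧ Step S c2 (.recv p p' a) c3 := by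
  induction h with
  | nil => intro hs ha; rw [hs] at ha; simp at ha
  | @cons c c' c'' ℓ ℓs h1 _ ih =>
    intro hs ha
    by_cases hl : ℓ = .recv p p' a
    · subst hl; exact ⟨[], _, _, Steps.nil, h1⟩
    · obtain ⟨φ', c2, c3, h2, h3⟩ := ih hs (mem_step h1 hl ha)
      exact ⟨_, _, _, Steps.cons h1 h2, h3⟩

end Helpers

/-- general input availability: in a basic, multiparty
compatible system, if a reachable configuration fires a send pp'!a and a
continuation containing no receive pp'?a follows, then the receive pp'?a
is still available after some further execution. -/
theorem general_input_availability [DecidableEq P] (S : Sys P Q A)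
    (hB : Basic S) (hMC : MultipartyCompatible S)
    (c c' c'' : Config P Q A) (p p' : P) (a : A) (φ : List (Act P A))
    (hreach : Reach S c)
    (hsend : Step S c (.send p p' a) c')
    (hsteps : Steps S c' φ c'')
    (hnot : Act.recv p p' a ∉ φ) :
    ∃ φ' c2 c3, Steps S c'' φ' c2 ∧ Step S c2 (.recv p p' a) c3 := by
  obtain ⟨φ0, h0⟩ := hreach
  have hall := steps_trans h0 (Steps.cons hsend hsteps)
  obtain ⟨ψ, e, hψ, he⟩ := completable hB hMC _ _ _ _ Reach1.init (fun _ => rfl) hall le_rfl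
  refine split_recv hψ he (mem_steps hsteps hnot ?_)
  cases hsend with
  | send _ => simp
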